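/- Tropicalization of the Igusa invariants on the theta cone: Assume α₁,…,α₆ ∈ K are pairwise distinct and nonzero with ω_i := −val(α_i) satisfying ω₁ < ω₂ < ω₃ = ω₄ < ω₅ < ω₆ and d₃₄ := −val(α₃ − α₄) < ω₃, and assume val(2) = 0. Set L₀ = 2(ω₃ − d₃₄), L₁ = 2(ω₅ − ω₃), L₂ = 2(ω₃ − ω₂). Then −val(A⁵/D) = −val(A³B/D) = −val(A²C/D) = L₀ + L₁ + L₂. -/

import Mathlib

namespace Genus2Igusa

variable {R : Type*} [CommRing R]

/-- `Δ_{ij} = (x − y)²`. -/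
def dlt (x y : R) : R := (x - y) ^ 2

/-- Triangle product `Δ_{ij}Δ_{jk}Δ_{ki}`. -/
def tri (x y z : R) : R := dlt x y * dlt y z * dlt z x

/-- Sum over the six bijections between `{i,j,k}` and `{l,m,n}` of
`Δ_{i,σ(i)}Δ_{j,σ(j)}Δ_{k,σ(k)}`. -/
def mtch (i j k l m n : R) : R :=
  dlt i l * dlt j m * dlt k n + dlt i l * dlt j n * dlt k m +
    dlt i m * dlt j l * dlt k n + dlt i m * dlt j n * dlt k l +
    dlt i n * dlt j l * dlt k m + dlt i n * dlt j m * dlt k l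

/-- `A`: sum of `Δ_{ij}Δ_{kl}Δ_{mn}` over the 15 partitions of `{1,…,6}` into three
pairs `{i,j},{k,l},{m,n}`. -/
def igusaA (a₁ a₂ a₃ a₄ a₅ a₆ : R) : R :=
  dlt a₁ a₂ * dlt a₃ a₄ * dlt a₅ a₆ + dlt a₁ a₂ * dlt a₃ a₅ * dlt a₄ a₆ +
    dlt a₁ a₂ * dlt a₃ a₆ * dlt a₄ a₅ +
  dlt a₁ a₃ * dlt a₂ a₄ * dlt a₅ a₆ + dlt a₁ a₃ * dlt a₂ a₅ * dlt a₄ a₆ +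
    dlt a₁ a₃ * dlt a₂ a₆ * dlt a₄ a₅ +
  dlt a₁ a₄ * dlt a₂ a₃ * dlt a₅ a₆ + dlt a₁ a₄ * dlt a₂ a₅ * dlt a₃ a₆ +
    dlt a₁ a₄ * dlt a₂ a₆ * dlt a₃ a₅ +
  dlt a₁ a₅ * dlt a₂ a₃ * dlt a₄ a₆ + dlt a₁ a₅ * dlt a₂ a₄ * dlt a₃ a₆ +
    dlt a₁ a₅ * dlt a₂ a₆ * dlt a₃ a₄ +
  dlt a₁ a₆ * dlt a₂ a₃ * dlt a₄ a₅ + dlt a₁ a₆ * dlt a₂ a₄ * dlt a₃ a₅ +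
    dlt a₁ a₆ * dlt a₂ a₅ * dlt a₃ a₄

/-- `B`: sum of `(Δ_{ij}Δ_{jk}Δ_{ki})(Δ_{lm}Δ_{mn}Δ_{nl})` over the 10 partitions of
`{1,…,6}` into two 3-element sets `{i,j,k},{l,m,n}`. -/
def igusaB (a₁ a₂ a₃ a₄ a₅ a₆ : R) : R :=
  tri a₁ a₂ a₃ * tri a₄ a₅ a₆ + tri a₁ a₂ a₄ * tri a₃ a₅ a₆ +
    tri a₁ a₂ a₅ * tri a₃ a₄ a₆ + tri a₁ a₂ a₆ * tri a₃ a₄ a₅ +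
    tri a₁ a₃ a₄ * tri a₂ a₅ a₆ + tri a₁ a₃ a₅ * tri a₂ a₄ a₆ +
    tri a₁ a₃ a₆ * tri a₂ a₄ a₅ + tri a₁ a₄ a₅ * tri a₂ a₃ a₆ +
    tri a₁ a₄ a₆ * tri a₂ a₃ a₅ + tri a₁ a₅ a₆ * tri a₂ a₃ a₄

/-- `C`: sum of `(Δ_{ij}Δ_{jk}Δ_{ki})(Δ_{lm}Δ_{mn}Δ_{nl})(Δ_{il}Δ_{jm}Δ_{kn})` over the
60 pairs consisting of a partition of `{1,…,6}` into two 3-element sets together with a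
bijection between them. -/
def igusaC (a₁ a₂ a₃ a₄ a₅ a₆ : R) : R :=
  tri a₁ a₂ a₃ * tri a₄ a₅ a₆ * mtch a₁ a₂ a₃ a₄ a₅ a₆ +
    tri a₁ a₂ a₄ * tri a₃ a₅ a₆ * mtch a₁ a₂ a₄ a₃ a₅ a₆ +
    tri a₁ a₂ a₅ * tri a₃ a₄ a₆ * mtch a₁ a₂ a₅ a₃ a₄ a₆ +
    tri a₁ a₂ a₆ * tri a₃ a₄ a₅ * mtch a₁ a₂ a₆ a₃ a₄ a₅ +
    tri a₁ a₃ a₄ * tri a₂ a₅ a₆ * mtch a₁ a₃ a₄ a₂ a₅ a₆ +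
    tri a₁ a₃ a₅ * tri a₂ a₄ a₆ * mtch a₁ a₃ a₅ a₂ a₄ a₆ +
    tri a₁ a₃ a₆ * tri a₂ a₄ a₅ * mtch a₁ a₃ a₆ a₂ a₄ a₅ +
    tri a₁ a₄ a₅ * tri a₂ a₃ a₆ * mtch a₁ a₄ a₅ a₂ a₃ a₆ +
    tri a₁ a₄ a₆ * tri a₂ a₃ a₅ * mtch a₁ a₄ a₆ a₂ a₃ a₅ +
    tri a₁ a₅ a₆ * tri a₂ a₃ a₄ * mtch a₁ a₅ a₆ a₂ a₃ a₄

/-- `D`: product of all `Δ_{ij}` for `1 ≤ i < j ≤ 6`. -/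
def igusaD (a₁ a₂ a₃ a₄ a₅ a₆ : R) : R :=
  dlt a₁ a₂ * dlt a₁ a₃ * dlt a₁ a₄ * dlt a₁ a₅ * dlt a₁ a₆ *
    dlt a₂ a₃ * dlt a₂ a₄ * dlt a₂ a₅ * dlt a₂ a₆ *
    dlt a₃ a₄ * dlt a₃ a₅ * dlt a₃ a₆ *
    dlt a₄ a₅ * dlt a₄ a₆ * dlt a₅ a₆


/-- `x = N * (c + e)` with `e` of positive valuation. -/
def Lead {K : Type*} [Field K] (v : AddValuation K (WithTop ℝ)) (c : ℕ) (N x : K) : Prop :=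
  ∃ e : K, 0 < v e ∧ x = N * (c + e)

section
variable {K : Type*} [Field K] {v : AddValuation K (WithTop ℝ)}

lemma val_nat (n : ℕ) : 0 ≤ v (n : K) := by
  induction n with
  | zero => simp
  | succ k ih =>
    push_cast
    exact v.map_le_add ih (by simp)

lemma val_add_pos {x y : K} (hx : 0 < v x) (hy : 0 < v y) : 0 < v (x + y) :=
  v.map_lt_add hx hy

lemma val_mul_pos {x y : K} (hx : 0 < v x) (hy : 0 ≤ v y) : 0 < v (x * y) := by
  rw [v.map_mul]; exact add_pos_of_pos_of_nonneg hx hy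

lemma Lead.add {c d : ℕ} {N x y : K} (hx : Lead v c N x) (hy : Lead v d N y) :
    Lead v (c + d) N (x + y) := by
  obtain ⟨e, he, rfl⟩ := hx
  obtain ⟨f, hf, rfl⟩ := hy
  exact ⟨e + f, val_add_pos he hf, by push_cast; ring⟩

lemma Lead.mul {c d : ℕ} {N M x y : K} (hx : Lead v c N x) (hy : Lead v d M y) :
    Lead v (c * d) (N * M) (x * y) := by
  obtain ⟨e, he, rfl⟩ := hx
  obtain ⟨f, hf, rfl⟩ := hy
  refine ⟨e * d + f * c + e * f, ?_, by push_cast; ring⟩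
  exact val_add_pos (val_add_pos (val_mul_pos he (val_nat d)) (val_mul_pos hf (val_nat c)))
    (val_mul_pos he hf.le)

lemma Lead.mul1 {N M x y : K} (hx : Lead v 1 N x) (hy : Lead v 1 M y) :
    Lead v 1 (N * M) (x * y) := hx.mul hy

lemma Lead.zero {c : ℕ} {N M x : K} {m n : ℝ} (hx : Lead v c M x) (hN : v N = (n : WithTop ℝ))
    (hM : v M = (m : WithTop ℝ)) (h : n < m) : Lead v 0 N x := by
  obtain ⟨e, he, rfl⟩ := hx
  have hN0 : N ≠ 0 := by
    rintro rfl
    simp at hN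
  have hq : 0 < v (M / N) := by
    have h1 : v (M / N) + v N = v M := by rw [← v.map_mul, div_mul_cancel₀ _ hN0]
    rw [hN, hM] at h1
    cases hh : v (M / N) with
    | top => exact WithTop.coe_lt_top 0
    | coe r =>
      rw [hh] at h1
      norm_cast at h1 ⊢
      linarith
  refine ⟨M / N * (c + e), val_mul_pos hq ?_, by field_simp; simp⟩
  exact v.map_le_add (val_nat c) he.le

lemma Lead.val_eq {c : ℕ} {N x : K} (hx : Lead v c N x) (hc : v (c : K) = 0) : v x = v N := by
  obtain ⟨e, he, rfl⟩ := hx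
  rw [v.map_mul, v.map_add_eq_of_lt_left (by rwa [hc]), hc, add_zero]

lemma Lead.refl (x : K) : Lead v 1 x x := ⟨0, by simp, by simp⟩

lemma Lead.congr {c : ℕ} {N M x y : K} (hx : Lead v c N x) (h1 : N = M) (h2 : y = x) :
    Lead v c M y := by subst h1 h2; exact hx

lemma lead_sub {m x y : K} {r s : ℝ} (hy : Lead v 1 m y) (hx : v x = (s : WithTop ℝ))
    (hm : v m = (r : WithTop ℝ)) (h : r < s) : Lead v 1 (m * m) (dlt x y) := by
  have hx' : Lead v 0 m x := (Lead.refl x).zero hm hx h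
  obtain ⟨e, he, rfl⟩ := hx'
  obtain ⟨f, hf, rfl⟩ := hy
  have hg : Lead v 1 m (m * (1 + (f - e))) :=
    ⟨f - e, by rw [sub_eq_add_neg]; exact val_add_pos hf (by rwa [v.map_neg]), by push_cast; ring⟩
  refine (hg.mul1 hg).congr rfl ?_
  unfold dlt; push_cast; ring

lemma dlt_comm (x y : K) : dlt x y = dlt y x := by unfold dlt; ring

lemma val_div {x y : K} {p q r : ℝ} (hx : v x = (p : WithTop ℝ)) (hy : v y = (q : WithTop ℝ))
    (h : p = r + q) : v (x / y) = (r : WithTop ℝ) := by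
  have hy0 : y ≠ 0 := by
    rintro rfl
    simp at hy
  have h1 : v (x / y) + v y = v x := by rw [← v.map_mul, div_mul_cancel₀ _ hy0]
  rw [hx, hy] at h1
  cases hh : v (x / y) with
  | top => rw [hh] at h1; simp at h1
  | coe t =>
    rw [hh] at h1
    norm_cast at h1 ⊢
    linarith

lemma vmul {x y : K} {p q : ℝ} (hx : v x = (p : WithTop ℝ)) (hy : v y = (q : WithTop ℝ)) :
    v (x * y) = ((p + q : ℝ) : WithTop ℝ) := by
  rw [v.map_mul, hx, hy]; rfl

lemma vpow {x : K} {p : ℝ} (hx : v x = (p : WithTop ℝ)) (n : ℕ) :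
    v (x ^ n) = ((n * p : ℝ) : WithTop ℝ) := by
  induction n with
  | zero => simp
  | succ k ih => rw [pow_succ, vmul ih hx, WithTop.coe_inj]; push_cast; ring

end

/-- **Tropicalization of the Igusa invariants on the theta cone (Type (II)).**
With `ω₁ < ω₂ < ω₃ = ω₄ < ω₅ < ω₆`, `d₃₄ = −val (α₃ − α₄) < ω₃`, residue characteristic
≠ 2 (`val 2 = 0`), and lengths `L₀ = 2(ω₃−d₃₄)`, `L₁ = 2(ω₅−ω₃)`, `L₂ = 2(ω₃−ω₂)`, all
three Igusa invariants satisfy `−val jᵢ = L₀ + L₁ + L₂`. -/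
theorem theta_tropical_igusa_invariants
    {K : Type*} [Field K] (val : K → WithTop ℝ)
    (hval0 : ∀ x : K, val x = ⊤ ↔ x = 0)
    (hvalmul : ∀ x y : K, val (x * y) = val x + val y)
    (hvaladd : ∀ x y : K, min (val x) (val y) ≤ val (x + y))
    (a₁ a₂ a₃ a₄ a₅ a₆ : K)
    (hdist : List.Pairwise (· ≠ ·) [a₁, a₂, a₃, a₄, a₅, a₆])
    (hne : ∀ a ∈ [a₁, a₂, a₃, a₄, a₅, a₆], a ≠ 0)
    (ω₁ ω₂ ω₃ ω₄ ω₅ ω₆ d₃₄ : ℝ)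
    (hω₁ : val a₁ = ((-ω₁ : ℝ) : WithTop ℝ)) (hω₂ : val a₂ = ((-ω₂ : ℝ) : WithTop ℝ))
    (hω₃ : val a₃ = ((-ω₃ : ℝ) : WithTop ℝ)) (hω₄ : val a₄ = ((-ω₄ : ℝ) : WithTop ℝ))
    (hω₅ : val a₅ = ((-ω₅ : ℝ) : WithTop ℝ)) (hω₆ : val a₆ = ((-ω₆ : ℝ) : WithTop ℝ))
    (h₁₂ : ω₁ < ω₂) (h₂₃ : ω₂ < ω₃) (h₃₄ : ω₃ = ω₄) (h₄₅ : ω₄ < ω₅) (h₅₆ : ω₅ < ω₆)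
    (hd₃₄ : val (a₃ - a₄) = ((-d₃₄ : ℝ) : WithTop ℝ)) (hd : d₃₄ < ω₃)
    (h2 : val (2 : K) = (0 : WithTop ℝ))
    (L₀ L₁ L₂ : ℝ)
    (hL₀ : L₀ = 2 * (ω₃ - d₃₄)) (hL₁ : L₁ = 2 * (ω₅ - ω₃)) (hL₂ : L₂ = 2 * (ω₃ - ω₂)) :
    let A := igusaA a₁ a₂ a₃ a₄ a₅ a₆
    let B := igusaB a₁ a₂ a₃ a₄ a₅ a₆
    let C := igusaC a₁ a₂ a₃ a₄ a₅ a₆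
    let D := igusaD a₁ a₂ a₃ a₄ a₅ a₆
    val (A ^ 5 / D) = ((-(L₀ + L₁ + L₂) : ℝ) : WithTop ℝ) ∧
    val (A ^ 3 * B / D) = ((-(L₀ + L₁ + L₂) : ℝ) : WithTop ℝ) ∧
    val (A ^ 2 * C / D) = ((-(L₀ + L₁ + L₂) : ℝ) : WithTop ℝ) := by
  intro A B C D
  subst h₃₄
  have h10 : val 1 = 0 := by
    have h := hvalmul 1 1
    have h' : val 1 ≠ ⊤ := fun h => one_ne_zero ((hval0 1).1 h)
    rw [mul_one] at h
    cases hh : val 1 with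
    | top => exact absurd hh h'
    | coe t =>
      rw [hh] at h
      norm_cast at h ⊢
      linarith
  obtain ⟨v, hv⟩ : ∃ v : AddValuation K (WithTop ℝ), ∀ x, v x = val x :=
    ⟨AddValuation.of val ((hval0 0).2 rfl) h10 hvaladd hvalmul, fun _ => rfl⟩
  simp only [← hv] at *
  have l4 : Lead v 1 a₃ a₄ := by
    obtain ⟨e, he, h⟩ := (Lead.refl (a₃ - a₄)).zero hω₃ hd₃₄ (by linarith)
    refine ⟨-e, by rwa [v.map_neg], ?_⟩
    push_cast at h ⊢
    linear_combination -h
  have h12 := lead_sub (Lead.refl a₂) hω₁ hω₂ (by linarith)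
  have k12 := vmul hω₂ hω₂
  have h13 := lead_sub (Lead.refl a₃) hω₁ hω₃ (by linarith)
  have k13 := vmul hω₃ hω₃
  have h14 := lead_sub l4 hω₁ hω₃ (by linarith)
  have k14 := vmul hω₃ hω₃
  have h15 := lead_sub (Lead.refl a₅) hω₁ hω₅ (by linarith)
  have k15 := vmul hω₅ hω₅
  have h16 := lead_sub (Lead.refl a₆) hω₁ hω₆ (by linarith)
  have k16 := vmul hω₆ hω₆
  have h23 := lead_sub (Lead.refl a₃) hω₂ hω₃ (by linarith)
  have k23 := vmul hω₃ hω₃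
  have h24 := lead_sub l4 hω₂ hω₃ (by linarith)
  have k24 := vmul hω₃ hω₃
  have h25 := lead_sub (Lead.refl a₅) hω₂ hω₅ (by linarith)
  have k25 := vmul hω₅ hω₅
  have h26 := lead_sub (Lead.refl a₆) hω₂ hω₆ (by linarith)
  have k26 := vmul hω₆ hω₆
  have h34 : Lead v 1 ((a₃ - a₄) * (a₃ - a₄)) (dlt a₃ a₄) := by
    unfold dlt; rw [pow_two]; exact Lead.refl _
  have k34 := vmul hd₃₄ hd₃₄
  have h35 := lead_sub (Lead.refl a₅) hω₃ hω₅ (by linarith)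
  have k35 := vmul hω₅ hω₅
  have h36 := lead_sub (Lead.refl a₆) hω₃ hω₆ (by linarith)
  have k36 := vmul hω₆ hω₆
  have h45 := lead_sub (Lead.refl a₅) hω₄ hω₅ (by linarith)
  have k45 := vmul hω₅ hω₅
  have h46 := lead_sub (Lead.refl a₆) hω₄ hω₆ (by linarith)
  have k46 := vmul hω₆ hω₆
  have h56 := lead_sub (Lead.refl a₆) hω₅ hω₆ (by linarith)
  have k56 := vmul hω₆ hω₆
  have hN := vmul (vmul (vmul hω₃ hω₃) (vmul hω₅ hω₅)) (vmul hω₆ hω₆)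
  obtain ⟨N, hNd⟩ : ∃ N, N = a₃ * a₃ * (a₅ * a₅) * (a₆ * a₆) := ⟨_, rfl⟩
  rw [← hNd] at hN
  have hN2 := vmul hN hN
  have m12_34_56 : Lead v 0 N (dlt a₁ a₂ * dlt a₃ a₄ * dlt a₅ a₆) :=
    Lead.zero (Lead.mul1 (Lead.mul1 h12 h34) h56) hN (vmul (vmul k12 k34) k56) (by linarith)
  have m12_35_46 : Lead v 0 N (dlt a₁ a₂ * dlt a₃ a₅ * dlt a₄ a₆) :=
    Lead.zero (Lead.mul1 (Lead.mul1 h12 h35) h46) hN (vmul (vmul k12 k35) k46) (by linarith)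
  have m12_36_45 : Lead v 0 N (dlt a₁ a₂ * dlt a₃ a₆ * dlt a₄ a₅) :=
    Lead.zero (Lead.mul1 (Lead.mul1 h12 h36) h45) hN (vmul (vmul k12 k36) k45) (by linarith)
  have m13_24_56 : Lead v 0 N (dlt a₁ a₃ * dlt a₂ a₄ * dlt a₅ a₆) :=
    Lead.zero (Lead.mul1 (Lead.mul1 h13 h24) h56) hN (vmul (vmul k13 k24) k56) (by linarith)
  have m13_25_46 : Lead v 1 N (dlt a₁ a₃ * dlt a₂ a₅ * dlt a₄ a₆) :=
    Lead.congr (Lead.mul1 (Lead.mul1 h13 h25) h46) (by rw [hNd] <;> ring) rfl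
  have m13_26_45 : Lead v 1 N (dlt a₁ a₃ * dlt a₂ a₆ * dlt a₄ a₅) :=
    Lead.congr (Lead.mul1 (Lead.mul1 h13 h26) h45) (by rw [hNd] <;> ring) rfl
  have m14_23_56 : Lead v 0 N (dlt a₁ a₄ * dlt a₂ a₃ * dlt a₅ a₆) :=
    Lead.zero (Lead.mul1 (Lead.mul1 h14 h23) h56) hN (vmul (vmul k14 k23) k56) (by linarith)
  have m14_25_36 : Lead v 1 N (dlt a₁ a₄ * dlt a₂ a₅ * dlt a₃ a₆) :=
    Lead.congr (Lead.mul1 (Lead.mul1 h14 h25) h36) (by rw [hNd] <;> ring) rfl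
  have m14_26_35 : Lead v 1 N (dlt a₁ a₄ * dlt a₂ a₆ * dlt a₃ a₅) :=
    Lead.congr (Lead.mul1 (Lead.mul1 h14 h26) h35) (by rw [hNd] <;> ring) rfl
  have m15_23_46 : Lead v 1 N (dlt a₁ a₅ * dlt a₂ a₃ * dlt a₄ a₆) :=
    Lead.congr (Lead.mul1 (Lead.mul1 h15 h23) h46) (by rw [hNd] <;> ring) rfl
  have m15_24_36 : Lead v 1 N (dlt a₁ a₅ * dlt a₂ a₄ * dlt a₃ a₆) :=
    Lead.congr (Lead.mul1 (Lead.mul1 h15 h24) h36) (by rw [hNd] <;> ring) rfl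
  have m15_26_34 : Lead v 0 N (dlt a₁ a₅ * dlt a₂ a₆ * dlt a₃ a₄) :=
    Lead.zero (Lead.mul1 (Lead.mul1 h15 h26) h34) hN (vmul (vmul k15 k26) k34) (by linarith)
  have m16_23_45 : Lead v 1 N (dlt a₁ a₆ * dlt a₂ a₃ * dlt a₄ a₅) :=
    Lead.congr (Lead.mul1 (Lead.mul1 h16 h23) h45) (by rw [hNd] <;> ring) rfl
  have m16_24_35 : Lead v 1 N (dlt a₁ a₆ * dlt a₂ a₄ * dlt a₃ a₅) :=
    Lead.congr (Lead.mul1 (Lead.mul1 h16 h24) h35) (by rw [hNd] <;> ring) rfl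
  have m16_25_34 : Lead v 0 N (dlt a₁ a₆ * dlt a₂ a₅ * dlt a₃ a₄) :=
    Lead.zero (Lead.mul1 (Lead.mul1 h16 h25) h34) hN (vmul (vmul k16 k25) k34) (by linarith)
  have hA : Lead v 8 N A := (Lead.add (Lead.add (Lead.add (Lead.add (Lead.add (Lead.add (Lead.add (Lead.add (Lead.add (Lead.add (Lead.add (Lead.add (Lead.add (Lead.add m12_34_56 m12_35_46) m12_36_45) m13_24_56) m13_25_46) m13_26_45) m14_23_56) m14_25_36) m14_26_35) m15_23_46) m15_24_36) m15_26_34) m16_23_45) m16_24_35) m16_25_34)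
  have t123 : Lead v 0 (N * N) (tri a₁ a₂ a₃ * tri a₄ a₅ a₆) := by
    unfold tri
    rw [dlt_comm a₃ a₁, dlt_comm a₆ a₄]
    exact Lead.zero (Lead.mul1 (Lead.mul1 (Lead.mul1 h12 h23) h13) (Lead.mul1 (Lead.mul1 h45 h56) h46)) hN2 (vmul (vmul (vmul k12 k23) k13) (vmul (vmul k45 k56) k46)) (by linarith)
  have u123 : Lead v 4 N (mtch a₁ a₂ a₃ a₄ a₅ a₆) := by
    refine Lead.congr (Lead.add (Lead.add (Lead.add (Lead.add (Lead.add m14_25_36 m14_26_35) m15_24_36) m15_26_34) m16_24_35) m16_25_34) rfl ?_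
    unfold mtch <;> ring
  have t124 : Lead v 0 (N * N) (tri a₁ a₂ a₄ * tri a₃ a₅ a₆) := by
    unfold tri
    rw [dlt_comm a₄ a₁, dlt_comm a₆ a₃]
    exact Lead.zero (Lead.mul1 (Lead.mul1 (Lead.mul1 h12 h24) h14) (Lead.mul1 (Lead.mul1 h35 h56) h36)) hN2 (vmul (vmul (vmul k12 k24) k14) (vmul (vmul k35 k56) k36)) (by linarith)
  have u124 : Lead v 4 N (mtch a₁ a₂ a₄ a₃ a₅ a₆) := by
    refine Lead.congr (Lead.add (Lead.add (Lead.add (Lead.add (Lead.add m13_25_46 m13_26_45) m15_23_46) m15_26_34) m16_23_45) m16_25_34) rfl ?_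
    simp only [mtch, dlt_comm a₄ a₃] <;> ring
  have t125 : Lead v 0 (N * N) (tri a₁ a₂ a₅ * tri a₃ a₄ a₆) := by
    unfold tri
    rw [dlt_comm a₅ a₁, dlt_comm a₆ a₃]
    exact Lead.zero (Lead.mul1 (Lead.mul1 (Lead.mul1 h12 h25) h15) (Lead.mul1 (Lead.mul1 h34 h46) h36)) hN2 (vmul (vmul (vmul k12 k25) k15) (vmul (vmul k34 k46) k36)) (by linarith)
  have u125 : Lead v 4 N (mtch a₁ a₂ a₅ a₃ a₄ a₆) := by
    refine Lead.congr (Lead.add (Lead.add (Lead.add (Lead.add (Lead.add m13_24_56 m13_26_45) m14_23_56) m14_26_35) m16_23_45) m16_24_35) rfl ?_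
    simp only [mtch, dlt_comm a₅ a₃, dlt_comm a₅ a₄] <;> ring
  have t126 : Lead v 0 (N * N) (tri a₁ a₂ a₆ * tri a₃ a₄ a₅) := by
    unfold tri
    rw [dlt_comm a₆ a₁, dlt_comm a₅ a₃]
    exact Lead.zero (Lead.mul1 (Lead.mul1 (Lead.mul1 h12 h26) h16) (Lead.mul1 (Lead.mul1 h34 h45) h35)) hN2 (vmul (vmul (vmul k12 k26) k16) (vmul (vmul k34 k45) k35)) (by linarith)
  have u126 : Lead v 4 N (mtch a₁ a₂ a₆ a₃ a₄ a₅) := by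
    refine Lead.congr (Lead.add (Lead.add (Lead.add (Lead.add (Lead.add m13_24_56 m13_25_46) m14_23_56) m14_25_36) m15_23_46) m15_24_36) rfl ?_
    simp only [mtch, dlt_comm a₆ a₃, dlt_comm a₆ a₄, dlt_comm a₆ a₅] <;> ring
  have t134 : Lead v 0 (N * N) (tri a₁ a₃ a₄ * tri a₂ a₅ a₆) := by
    unfold tri
    rw [dlt_comm a₄ a₁, dlt_comm a₆ a₂]
    exact Lead.zero (Lead.mul1 (Lead.mul1 (Lead.mul1 h13 h34) h14) (Lead.mul1 (Lead.mul1 h25 h56) h26)) hN2 (vmul (vmul (vmul k13 k34) k14) (vmul (vmul k25 k56) k26)) (by linarith)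
  have u134 : Lead v 4 N (mtch a₁ a₃ a₄ a₂ a₅ a₆) := by
    refine Lead.congr (Lead.add (Lead.add (Lead.add (Lead.add (Lead.add m12_35_46 m12_36_45) m15_23_46) m15_24_36) m16_23_45) m16_24_35) rfl ?_
    simp only [mtch, dlt_comm a₃ a₂, dlt_comm a₄ a₂] <;> ring
  have t135 : Lead v 1 (N * N) (tri a₁ a₃ a₅ * tri a₂ a₄ a₆) := by
    unfold tri
    rw [dlt_comm a₅ a₁, dlt_comm a₆ a₂]
    exact Lead.congr (Lead.mul1 (Lead.mul1 (Lead.mul1 h13 h35) h15) (Lead.mul1 (Lead.mul1 h24 h46) h26)) (by rw [hNd] <;> ring) rfl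
  have u135 : Lead v 2 N (mtch a₁ a₃ a₅ a₂ a₄ a₆) := by
    refine Lead.congr (Lead.add (Lead.add (Lead.add (Lead.add (Lead.add m12_34_56 m12_36_45) m14_23_56) m14_25_36) m16_23_45) m16_25_34) rfl ?_
    simp only [mtch, dlt_comm a₃ a₂, dlt_comm a₅ a₂, dlt_comm a₅ a₄] <;> ring
  have t136 : Lead v 1 (N * N) (tri a₁ a₃ a₆ * tri a₂ a₄ a₅) := by
    unfold tri
    rw [dlt_comm a₆ a₁, dlt_comm a₅ a₂]
    exact Lead.congr (Lead.mul1 (Lead.mul1 (Lead.mul1 h13 h36) h16) (Lead.mul1 (Lead.mul1 h24 h45) h25)) (by rw [hNd] <;> ring) rfl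
  have u136 : Lead v 2 N (mtch a₁ a₃ a₆ a₂ a₄ a₅) := by
    refine Lead.congr (Lead.add (Lead.add (Lead.add (Lead.add (Lead.add m12_34_56 m12_35_46) m14_23_56) m14_26_35) m15_23_46) m15_26_34) rfl ?_
    simp only [mtch, dlt_comm a₃ a₂, dlt_comm a₆ a₂, dlt_comm a₆ a₄, dlt_comm a₆ a₅] <;> ring
  have t145 : Lead v 1 (N * N) (tri a₁ a₄ a₅ * tri a₂ a₃ a₆) := by
    unfold tri
    rw [dlt_comm a₅ a₁, dlt_comm a₆ a₂]
    exact Lead.congr (Lead.mul1 (Lead.mul1 (Lead.mul1 h14 h45) h15) (Lead.mul1 (Lead.mul1 h23 h36) h26)) (by rw [hNd] <;> ring) rfl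
  have u145 : Lead v 2 N (mtch a₁ a₄ a₅ a₂ a₃ a₆) := by
    refine Lead.congr (Lead.add (Lead.add (Lead.add (Lead.add (Lead.add m12_34_56 m12_35_46) m13_24_56) m13_25_46) m16_24_35) m16_25_34) rfl ?_
    simp only [mtch, dlt_comm a₄ a₂, dlt_comm a₄ a₃, dlt_comm a₅ a₂, dlt_comm a₅ a₃] <;> ring
  have t146 : Lead v 1 (N * N) (tri a₁ a₄ a₆ * tri a₂ a₃ a₅) := by
    unfold tri
    rw [dlt_comm a₆ a₁, dlt_comm a₅ a₂]
    exact Lead.congr (Lead.mul1 (Lead.mul1 (Lead.mul1 h14 h46) h16) (Lead.mul1 (Lead.mul1 h23 h35) h25)) (by rw [hNd] <;> ring) rfl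
  have u146 : Lead v 2 N (mtch a₁ a₄ a₆ a₂ a₃ a₅) := by
    refine Lead.congr (Lead.add (Lead.add (Lead.add (Lead.add (Lead.add m12_34_56 m12_36_45) m13_24_56) m13_26_45) m15_24_36) m15_26_34) rfl ?_
    simp only [mtch, dlt_comm a₄ a₂, dlt_comm a₄ a₃, dlt_comm a₆ a₂, dlt_comm a₆ a₃, dlt_comm a₆ a₅] <;> ring
  have t156 : Lead v 0 (N * N) (tri a₁ a₅ a₆ * tri a₂ a₃ a₄) := by
    unfold tri
    rw [dlt_comm a₆ a₁, dlt_comm a₄ a₂]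
    exact Lead.zero (Lead.mul1 (Lead.mul1 (Lead.mul1 h15 h56) h16) (Lead.mul1 (Lead.mul1 h23 h34) h24)) hN2 (vmul (vmul (vmul k15 k56) k16) (vmul (vmul k23 k34) k24)) (by linarith)
  have u156 : Lead v 4 N (mtch a₁ a₅ a₆ a₂ a₃ a₄) := by
    refine Lead.congr (Lead.add (Lead.add (Lead.add (Lead.add (Lead.add m12_35_46 m12_36_45) m13_25_46) m13_26_45) m14_25_36) m14_26_35) rfl ?_
    simp only [mtch, dlt_comm a₅ a₂, dlt_comm a₅ a₃, dlt_comm a₅ a₄, dlt_comm a₆ a₂, dlt_comm a₆ a₃, dlt_comm a₆ a₄] <;> ring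
  have hB : Lead v 4 (N * N) B := (Lead.add (Lead.add (Lead.add (Lead.add (Lead.add (Lead.add (Lead.add (Lead.add (Lead.add t123 t124) t125) t126) t134) t135) t136) t145) t146) t156)
  have hC : Lead v 8 (N * N * N) C := (Lead.add (Lead.add (Lead.add (Lead.add (Lead.add (Lead.add (Lead.add (Lead.add (Lead.add (Lead.mul t123 u123) (Lead.mul t124 u124)) (Lead.mul t125 u125)) (Lead.mul t126 u126)) (Lead.mul t134 u134)) (Lead.mul t135 u135)) (Lead.mul t136 u136)) (Lead.mul t145 u145)) (Lead.mul t146 u146)) (Lead.mul t156 u156))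
  have h4 : v ((4 : ℕ) : K) = 0 := by
    rw [show ((4 : ℕ) : K) = 2 * 2 by norm_num, v.map_mul, h2, add_zero]
  have h8 : v ((8 : ℕ) : K) = 0 := by
    rw [show ((8 : ℕ) : K) = 2 * 2 * 2 by norm_num, v.map_mul, v.map_mul, h2, add_zero, add_zero]
  have vA := (hA.val_eq h8).trans hN
  have vB := (hB.val_eq h4).trans hN2
  have vC := (hC.val_eq h8).trans (vmul hN2 hN)
  have h1 : v ((1 : ℕ) : K) = 0 := by simp
  have vD : v D = _ :=
    (Lead.val_eq (Lead.mul1 (Lead.mul1 (Lead.mul1 (Lead.mul1 (Lead.mul1 (Lead.mul1 (Lead.mul1 (Lead.mul1 (Lead.mul1 (Lead.mul1 (Lead.mul1 (Lead.mul1 (Lead.mul1 (Lead.mul1 h12 h13) h14) h15) h16) h23) h24) h25) h26) h34) h35) h36) h45) h46) h56) h1).trans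
    (vmul (vmul (vmul (vmul (vmul (vmul (vmul (vmul (vmul (vmul (vmul (vmul (vmul (vmul k12 k13) k14) k15) k16) k23) k24) k25) k26) k34) k35) k36) k45) k46) k56)
  refine ⟨val_div (vpow vA 5) vD ?_, val_div (vmul (vpow vA 3) vB) vD ?_,
    val_div (vmul (vpow vA 2) vC) vD ?_⟩ <;> (push_cast; linarith)

end Genus2Igusa
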